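/- Let n, c, a be positive integers with c ≥ 3. There exists an n-vertex polyunsaturated SGK graph G with clique number c and independence number a if and only if all of the following hold: (1) a ≥ c - 2; (2) n ≥ a + 1 + binom(c-1, 2); (3) n ≤ c·a + 1 - binom(c-1, 2). Moreover, G may be chosen so that both G and its complement are comparability graphs. -/

import Mathlib

/-- `s` is an independent set of the graph `G`. -/
def IndepSet {V : Type*} (G : SimpleGraph V) (s : Set V) : Prop :=
  ∀ ⦃v⦄, v ∈ s → ∀ ⦃w⦄, w ∈ s → ¬ G.Adj v w

/-- `α_k(G)`: the maximum number of vertices in a union of `k` independent sets. -/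
noncomputable def alphak {V : Type*} (G : SimpleGraph V) (k : ℕ) : ℕ :=
  sSup {n | ∃ A : Fin k → Set V, (∀ i, IndepSet G (A i)) ∧ (⋃ i, A i).ncard = n}

/-- `ω_k(G)`: the maximum number of vertices in a union of `k` cliques. -/
noncomputable def omegak {V : Type*} (G : SimpleGraph V) (k : ℕ) : ℕ :=
  sSup {n | ∃ A : Fin k → Set V, (∀ i, G.IsClique (A i)) ∧ (⋃ i, A i).ncard = n}

/-- The clique number `ω(G)`. -/
noncomputable def cliqueNumber {V : Type*} (G : SimpleGraph V) : ℕ :=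
  sSup {n | ∃ s : Set V, G.IsClique s ∧ s.ncard = n}

/-- The independence number `α(G)`. -/
noncomputable def indepNumber {V : Type*} (G : SimpleGraph V) : ℕ :=
  sSup {n | ∃ s : Set V, IndepSet G s ∧ s.ncard = n}

/-- `f` encodes a partition of the vertices of `G` into cliques:
its (nonempty) fibers are the cliques. -/
def IsCliquePartition {V : Type*} (G : SimpleGraph V) (f : V → V) : Prop :=
  ∀ i : V, G.IsClique (f ⁻¹' {i})

/-- The `k`-norm of the partition encoded by `f`: `Σ_C min (k, |C|)`. -/
noncomputable def knorm {V : Type*} [Fintype V] (f : V → V) (k : ℕ) : ℕ :=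
  ∑ i : V, min k (f ⁻¹' {i}).ncard

/-- `G` is a strong Greene–Kleitman (SGK) graph: every induced subgraph has, for every
positive `k`, a clique partition that is simultaneously `k`- and `k+1`-saturated. -/
def SGK {V : Type*} [Fintype V] (G : SimpleGraph V) : Prop :=
  ∀ (s : Finset V) (k : ℕ), 0 < k →
    ∃ f : (↑s : Set V) → (↑s : Set V),
      IsCliquePartition (G.induce ↑s) f ∧
      knorm f k = alphak (G.induce ↑s) k ∧
      knorm f (k + 1) = alphak (G.induce ↑s) (k + 1)

/-- An SGK graph is polyunsaturated if no clique partition is simultaneously `k`- and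
`l`-saturated for distinct nonconsecutive positive `k, l` below the clique number. -/
def PolyunsatG {V : Type*} [Fintype V] (G : SimpleGraph V) : Prop :=
  ∀ k l : ℕ, 0 < k → 0 < l → k < cliqueNumber G → l < cliqueNumber G →
    (k + 2 ≤ l ∨ l + 2 ≤ k) →
    ¬ ∃ f : V → V, IsCliquePartition G f ∧ knorm f k = alphak G k ∧ knorm f l = alphak G l

/-- `G` is a comparability graph: adjacency is comparability in some partial order. -/
def IsComparabilityGraph {V : Type*} (G : SimpleGraph V) : Prop :=
  ∃ r : V → V → Prop, IsPartialOrder V r ∧ ∀ v w, G.Adj v w ↔ (v ≠ w ∧ (r v w ∨ r w v))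

open Finset

theorem IsCliquePartition.adj {V : Type*} {G : SimpleGraph V} {f : V → V}
    (hf : IsCliquePartition G f) (v w : V) (h : f v = f w) (hne : v ≠ w) : G.Adj v w :=
  hf (f w) (by simpa using h) (by simp) hne

section Saturation

variable {V : Type*} [Fintype V] {G : SimpleGraph V}

theorem ncard_le_alphak {k : ℕ} (A : Fin k → Set V) (hA : ∀ i, IndepSet G (A i)) :
    (⋃ i, A i).ncard ≤ alphak G k := by
  refine le_csSup ⟨Fintype.card V, ?_⟩ ⟨A, hA, rfl⟩
  rintro _ ⟨B, -, rfl⟩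
  rw [← Nat.card_eq_fintype_card]
  exact Set.ncard_le_card _

theorem exists_ncard_eq_alphak (G : SimpleGraph V) (k : ℕ) :
    ∃ A : Fin k → Set V, (∀ i, IndepSet G (A i)) ∧ (⋃ i, A i).ncard = alphak G k := by
  have := Nat.sSup_mem (s := {n | ∃ A : Fin k → Set V, (∀ i, IndepSet G (A i)) ∧
    (⋃ i, A i).ncard = n}) ⟨_, fun _ => ∅, fun _ v hv => hv.elim, rfl⟩ ⟨Fintype.card V, ?_⟩
  · exact this
  · rintro _ ⟨B, -, rfl⟩
    rw [← Nat.card_eq_fintype_card]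
    exact Set.ncard_le_card _

/-- A union of color classes of a partial proper coloring with colors below `k`. -/
theorem card_filter_lt_le_alphak (k : ℕ) (col : V → ℕ)
    (hcol : ∀ v w, col v = col w → col v < k → ¬ G.Adj v w) :
    #{v | col v < k} ≤ alphak G k := by
  refine le_trans (le_of_eq ?_) (ncard_le_alphak (fun i : Fin k => {v | col v = i}) ?_)
  · rw [← Set.ncard_coe_finset]
    congr 1
    ext v
    simp only [coe_filter, mem_univ, true_and, Set.mem_ofPred_eq, Set.mem_iUnion]
    exact ⟨fun h => ⟨⟨_, h⟩, rfl⟩, fun ⟨i, h⟩ => h ▸ i.2⟩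
  · intro i v hv w hw
    simp only [Set.mem_ofPred_eq] at hv hw
    exact hcol v w (hv.trans hw.symm) (hv ▸ i.2)

/-- A maximum union of `k` independent sets, presented as a partial coloring. -/
theorem exists_coloring_alphak (G : SimpleGraph V) (k : ℕ) :
    ∃ col : V → ℕ, (∀ v w, col v = col w → col v < k → ¬ G.Adj v w) ∧
      #{v | col v < k} = alphak G k := by
  classical
  obtain ⟨A, hA, hc⟩ := exists_ncard_eq_alphak G k
  refine ⟨fun v => if h : ∃ i, v ∈ A i then (h.choose : ℕ) else k, ?_, ?_⟩
  · intro v w hvw hv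
    dsimp only at hvw hv
    split_ifs at hvw hv with h1 h2 h2
    · have hw := h2.choose_spec
      rw [← Fin.ext hvw] at hw
      exact hA _ h1.choose_spec hw
    · omega
    · omega
    · omega
  · rw [← hc, ← Set.ncard_coe_finset]
    congr 1
    ext v
    simp only [coe_filter, mem_univ, true_and, Set.mem_ofPred_eq, Set.mem_iUnion]
    split_ifs with h
    · exact ⟨fun _ => h, fun _ => h.choose.2⟩
    · exact ⟨fun h' => (lt_irrefl _ h').elim, fun h' => (h h').elim⟩

theorem card_fiber_filter_le {ι : Type*} [DecidableEq ι] {k : ℕ} {col : V → ℕ}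
    (hcol : ∀ v w, col v = col w → col v < k → ¬ G.Adj v w) {g : V → ι}
    (hg : ∀ v w, g v = g w → v ≠ w → G.Adj v w) (i : ι) :
    #{v | col v < k ∧ g v = i} ≤ k := by
  conv_rhs => rw [← Finset.card_range k]
  refine card_le_card_of_injOn col (fun v hv => ?_) (fun v hv w hw h => ?_)
  · simp only [coe_filter, mem_univ, true_and, Set.mem_ofPred_eq] at hv
    simpa using hv.1
  · simp only [coe_filter, mem_univ, true_and, Set.mem_ofPred_eq] at hv hw
    by_contra hne
    exact hcol v w h hv.1 (hg v w (hv.2.trans hw.2.symm) hne)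

theorem knorm_eq [DecidableEq V] (f : V → V) (k : ℕ) :
    knorm f k = ∑ i, min k #{v | f v = i} := by
  unfold knorm
  refine sum_congr rfl fun i _ => ?_
  rw [← Set.ncard_coe_finset]
  congr 2
  ext v
  simp

theorem alphak_le_knorm {f : V → V} (hf : IsCliquePartition G f) (k : ℕ) :
    alphak G k ≤ knorm f k := by
  classical
  obtain ⟨col, hcol, hc⟩ := exists_coloring_alphak G k
  rw [← hc, knorm_eq, card_eq_sum_card_fiberwise (f := f) (t := univ) (fun _ _ => by simp)]
  refine sum_le_sum fun i _ => ?_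
  rw [filter_filter]
  exact le_min (card_fiber_filter_le hcol hf.adj i) (card_le_card fun v => by simp)

/-- If some partition into cliques shows that a `k`-colored set `U` is maximum, in the sense that
each clique inside it is contained in `U` or meets all color classes, then every `k`-saturated
partition has this property. -/
theorem saturated_meets_colors {ι : Type*} {k : ℕ} {col : V → ℕ}
    (hcol : ∀ v w, col v = col w → col v < k → ¬ G.Adj v w) {g : V → ι}
    (hg : ∀ v w, g v = g w → v ≠ w → G.Adj v w)
    (hU : ∀ v, k ≤ col v → ∀ i < k, ∃ w, g w = g v ∧ col w = i)
    {f : V → V} (hf : IsCliquePartition G f) (hfk : knorm f k = alphak G k)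
    (v : V) (hv : k ≤ col v) (i : ℕ) (hi : i < k) : ∃ w, f w = f v ∧ col w = i := by
  classical
  have hle : alphak G k ≤ #{v | col v < k} := by
    obtain ⟨col', hcol', hc⟩ := exists_coloring_alphak G k
    rw [← hc, card_eq_sum_card_fiberwise (f := g) (t := univ.image g) (fun _ _ => by simp),
      card_eq_sum_card_fiberwise (s := {v | col v < k}) (f := g) (t := univ.image g)
        (fun _ _ => by simp)]
    refine sum_le_sum fun i _ => ?_
    rw [filter_filter, filter_filter]
    by_cases h : ∀ v, g v = i → col v < k
    · exact card_le_card fun v => by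
        simp only [mem_filter, mem_univ, true_and, and_imp]
        exact fun _ h2 => ⟨h v h2, h2⟩
    · push Not at h
      obtain ⟨v, hvi, hvk⟩ := h
      refine (card_fiber_filter_le hcol' hg i).trans ?_
      have : Nonempty V := ⟨v⟩
      choose! u hu1 hu2 using hU v hvk
      conv_lhs => rw [← Finset.card_range k]
      refine card_le_card_of_injOn u (fun j hj => ?_) (fun j hj j' hj' h => ?_)
      · have hj : j < k := by simpa using hj
        simpa [hu2 j hj, hj] using (hu1 j hj).trans hvi
      · have hj : j < k := by simpa using hj
        have hj' : j' < k := by simpa using hj'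
        rw [← hu2 j hj, ← hu2 j' hj', h]
  have hpt : ∀ i ∈ (univ : Finset V), #{v | col v < k ∧ f v = i} ≤ min k #{v | f v = i} :=
    fun i _ => le_min (card_fiber_filter_le hcol hf.adj i) (card_le_card fun v => by simp)
  have hsum : ∑ i, #{v | col v < k ∧ f v = i} = ∑ i, min k #{v | f v = i} := by
    refine le_antisymm (sum_le_sum hpt) ?_
    refine (le_of_eq ?_).trans (hle.trans (le_of_eq ?_))
    · rw [← hfk, knorm_eq]
    rw [card_eq_sum_card_fiberwise (f := f) (t := univ) (fun _ _ => by simp)]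
    simp_rw [filter_filter]
  have heq := (sum_eq_sum_iff_of_le hpt).1 hsum (f v) (mem_univ _)
  by_contra! hno
  have h1 : #{w | col w < k ∧ f w = f v} < #{w | f w = f v} := by
    refine card_lt_card ⟨fun w => by simp, fun h => ?_⟩
    have := @h v (by simp)
    simp only [mem_filter, mem_univ, true_and] at this
    omega
  have h2 : #{w | col w < k ∧ f w = f v} < k := by
    have : #{w | col w < k ∧ f w = f v} ≤ #((range k).erase i) := by
      refine card_le_card_of_injOn col (fun w hw => ?_) (fun w hw w' hw' h => ?_)
      · simp only [coe_filter, mem_univ, true_and, Set.mem_ofPred_eq] at hw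
        simp [hw.1, hno w hw.2]
      · simp only [coe_filter, mem_univ, true_and, Set.mem_ofPred_eq] at hw hw'
        by_contra hne
        exact hcol w w' h hw.1 (hf.adj w w' (hw.2.trans hw'.2.symm) hne)
    rw [card_erase_of_mem (by simpa using hi), Finset.card_range] at this
    omega
  omega

end Saturation

section Assignment

variable {V : Type*} [Fintype V]

/-- Egerváry's theorem: integral duality for the assignment problem. -/
theorem exists_perm_tight_potentials (cost : V → V → ℤ) :
    ∃ (σ : V → V) (a b : V → ℤ), Function.Injective σ ∧ (∀ v w, a v + b w ≤ cost v w) ∧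
      ∀ v, a v + b (σ v) = cost v (σ v) := by
  classical
  let F : Set ℤ := {t | ∃ a b : V → ℤ, (∀ v w, a v + b w ≤ cost v w) ∧ ∑ v, (a v + b v) = t}
  have hne : F.Nonempty := by
    refine ⟨_, fun _ => -∑ v, ∑ w, |cost v w|, fun _ => 0, fun v w => ?_, rfl⟩
    have h1 : |cost v w| ≤ ∑ w, |cost v w| :=
      single_le_sum (f := fun w => |cost v w|) (fun _ _ => abs_nonneg _) (mem_univ w)
    have h2 : ∑ w, |cost v w| ≤ ∑ v, ∑ w, |cost v w| :=
      single_le_sum (f := fun v => ∑ w, |cost v w|)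
        (fun _ _ => sum_nonneg fun _ _ => abs_nonneg _) (mem_univ v)
    have h3 := neg_abs_le (cost v w)
    dsimp only
    omega
  have hbdd : BddAbove F := by
    refine ⟨∑ v, cost v v, ?_⟩
    rintro _ ⟨a, b, h, rfl⟩
    exact sum_le_sum fun v _ => h v v
  obtain ⟨a, b, hab, hmax⟩ := Int.csSup_mem hne hbdd
  have hopt : ∀ a' b' : V → ℤ, (∀ v w, a' v + b' w ≤ cost v w) →
      ∑ v, (a' v + b' v) ≤ ∑ v, (a v + b v) := fun a' b' h => by
    rw [hmax]
    exact le_csSup hbdd ⟨a', b', h, rfl⟩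
  let t : V → Finset V := fun v => {w | a v + b w = cost v w}
  have hall : ∀ S : Finset V, #S ≤ #(S.biUnion t) := by
    intro S
    by_contra! hlt
    have := hopt (fun v => a v + if v ∈ S then 1 else 0)
      (fun w => b w - if w ∈ S.biUnion t then 1 else 0) (fun v w => by
        have h := hab v w
        by_cases hv : v ∈ S
        · by_cases hw : w ∈ S.biUnion t
          · simp only [hv, hw, if_true]; omega
          · have : a v + b w ≠ cost v w := fun he =>
              hw (mem_biUnion.2 ⟨v, hv, by simpa [t] using he⟩)
            simp only [hv, hw, if_true, if_false]; omega
        · simp only [hv, if_false]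
          split_ifs <;> omega)
    simp only [sum_add_distrib, sum_sub_distrib, sum_ite_mem, univ_inter, sum_const,
      nsmul_eq_mul, mul_one] at this
    omega
  obtain ⟨σ, hσ, hσt⟩ := (all_card_le_biUnion_card_iff_exists_injective t).1 hall
  exact ⟨σ, a, b, hσ, hab, fun v => by simpa [t] using hσt v⟩

end Assignment

section GreeneKleitman

variable {V : Type*} [Fintype V]

/-- The partition of a poset into the maximal ascending runs of an injective self-map. -/
theorem exists_chain_partition_of_injective [PartialOrder V] {σ : V → V}
    (hσ : Function.Injective σ) :
    ∃ f : V → V, (∀ v w, f v = f w → v ≤ w ∨ w ≤ v) ∧ (∀ v, ¬ f v < σ (f v)) ∧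
      ∀ v, σ (f v) = f v → v = f v := by
  classical
  let R : V → V → Prop := fun v w => v < σ v ∧ w = σ v
  have hex : ∀ v, ∃ w, Relation.ReflTransGen R v w ∧ ¬ w < σ w := by
    intro v
    induction v using WellFoundedGT.induction with
    | ind v ih =>
      by_cases h : v < σ v
      · obtain ⟨w, hw, hw'⟩ := ih (σ v) h
        exact ⟨w, hw.head ⟨h, rfl⟩, hw'⟩
      · exact ⟨v, .refl, h⟩
  choose f hf hf' using hex
  have hle : ∀ {v w}, Relation.ReflTransGen R v w → v ≤ w := by
    intro v w h
    induction h with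
    | refl => exact le_rfl
    | tail _ h ih => exact ih.trans (h.2 ▸ h.1.le)
  refine ⟨f, fun v w h => ?_, hf', fun v h => ?_⟩
  · have hu : Relator.RightUnique (Function.swap R) := by
      rintro x y z ⟨-, hy⟩ ⟨-, hz⟩
      exact hσ (hy.symm.trans hz)
    have hv := hf v
    rw [h, ← Relation.reflTransGen_swap] at hv
    have hw := hf w
    rw [← Relation.reflTransGen_swap] at hw
    rcases Relation.ReflTransGen.total_of_right_unique hu hv hw with h | h
    · exact .inr (hle (Relation.reflTransGen_swap.1 h))
    · exact .inl (hle (Relation.reflTransGen_swap.1 h))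
  · rcases Relation.ReflTransGen.cases_tail (hf v) with h' | ⟨u, -, hu, hu'⟩
    · exact h'.symm
    · have : u = f v := hσ (hu'.symm.trans h.symm)
      rw [this, h] at hu
      exact (lt_irrefl _ hu).elim

/-- The Greene–Kleitman theorem for comparability graphs, with simultaneous saturation. -/
theorem exists_saturated_of_partialOrder [PartialOrder V] {G : SimpleGraph V}
    (hG : ∀ v w, G.Adj v w ↔ v < w ∨ w < v) {k : ℕ} (hk : 0 < k) :
    ∃ f : V → V, IsCliquePartition G f ∧ knorm f k = alphak G k ∧
      knorm f (k + 1) = alphak G (k + 1) := by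
  classical
  cases isEmpty_or_nonempty V with
  | inl h =>
    refine ⟨id, fun i => h.elim i, ?_, ?_⟩
    all_goals
      refine le_antisymm ?_ (alphak_le_knorm (fun i => h.elim i) _)
      simp [knorm]
  | inr h =>
  obtain ⟨σ, a, b, hσ, hab, heq⟩ := exists_perm_tight_potentials
    (fun v w : V => if v < w then 0 else if v = w then 2 else 2 * (k : ℤ) + 1)
  obtain ⟨f, hf, hf1, hf2⟩ := exists_chain_partition_of_injective hσ
  have hclique : IsCliquePartition G f := fun i v hv w hw hne => by
    rw [hG]
    rcases hf v w (hv.trans hw.symm) with h | h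
    · exact .inl (lt_of_le_of_ne h hne)
    · exact .inr (lt_of_le_of_ne h hne.symm)
  -- the cost of the assignment bounds the sum of the two norms
  have hprimal : ((knorm f k + knorm f (k + 1) : ℕ) : ℤ) ≤ ∑ v, (a v + b v) := by
    have h1 : ∑ v, (a v + b v) = ∑ v, (a v + b (σ v)) := by
      rw [sum_add_distrib, sum_add_distrib]
      congr 1
      exact ((Equiv.ofBijective σ (Finite.injective_iff_bijective.1 hσ)).sum_comp b).symm
    rw [h1, knorm_eq, knorm_eq, ← sum_add_distrib, Nat.cast_sum]
    refine sum_le_sum fun i _ => ?_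
    rw [heq]
    split_ifs with h1 h2
    · have : #{v | f v = i} = 0 := by
        rw [card_eq_zero, filter_eq_empty_iff]
        rintro v - rfl
        exact hf1 v h1
      simp [this]
    · have : #{v | f v = i} ≤ 1 := by
        refine card_le_one.2 fun v hv w hw => ?_
        simp only [mem_filter, mem_univ, true_and] at hv hw
        rw [hf2 v (by rw [hv, ← h2]), hf2 w (by rw [hw, ← h2]), hv, hw]
      omega
    · omega
  -- normalize the potentials
  obtain ⟨z, -, hz⟩ := exists_max_image univ b univ_nonempty
  let a' : V → ℤ := fun v => a v + b z - (2 * k + 1)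
  let b' : V → ℤ := fun v => b v - b z + (2 * k + 1)
  have ha' : ∀ v, a' v ≤ 0 := fun v => by
    have := hab v z
    dsimp only [a'] at this ⊢
    split_ifs at this with h1 h2
    · omega
    · omega
    · omega
  have hb' : ∀ v, b' v ≤ 2 * k + 1 := fun v => by
    have := hz v (mem_univ _)
    dsimp only [b']
    omega
  have hab' : ∀ v w, v < w → a' v + b' w ≤ 0 := fun v w h => by
    have := hab v w
    simp only [h, if_true] at this
    dsimp only [a', b']
    omega
  have hvv : ∀ v, a' v + b' v ≤ 2 := fun v => by
    have := hab v v
    simp only [lt_irrefl, if_true, if_false] at this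
    dsimp only [a', b']
    omega
  have hsum : ∑ v, (a v + b v) = ∑ v, (a' v + b' v) :=
    sum_congr rfl fun v _ => by dsimp only [a', b']; omega
  -- the antichains of even and of odd level
  let even : V → ℕ := fun v => if -a' v < 2 * (b' v / 2) then (b' v / 2 - 1).toNat else k
  let odd : V → ℕ := fun v =>
    if -a' v < 2 * ((b' v - 1) / 2) + 1 then ((b' v - 1) / 2).toNat else k + 1
  have heven : #{v | even v < k} ≤ alphak G k := by
    refine card_filter_lt_le_alphak k even fun v w h hv hadj => ?_
    have h1 := ha' v
    have h2 := ha' w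
    dsimp only [even] at h hv
    rcases (hG v w).1 hadj with hlt | hlt <;> have h3 := hab' _ _ hlt <;>
      split_ifs at h hv <;> omega
  have hodd : #{v | odd v < k + 1} ≤ alphak G (k + 1) := by
    refine card_filter_lt_le_alphak (k + 1) odd fun v w h hv hadj => ?_
    have h1 := ha' v
    have h2 := ha' w
    dsimp only [odd] at h hv
    rcases (hG v w).1 hadj with hlt | hlt <;> have h3 := hab' _ _ hlt <;>
      split_ifs at h hv <;> omega
  have hdual : ∑ v, (a' v + b' v) ≤ ((#{v | even v < k} + #{v | odd v < k + 1} : ℕ) : ℤ) := by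
    rw [card_filter, card_filter, ← sum_add_distrib, Nat.cast_sum]
    refine sum_le_sum fun v _ => ?_
    have h1 := ha' v
    have h2 := hb' v
    have h3 := hvv v
    dsimp only [even, odd]
    split_ifs <;> omega
  have hw1 := alphak_le_knorm hclique k
  have hw2 := alphak_le_knorm hclique (k + 1)
  refine ⟨f, hclique, ?_, ?_⟩ <;> omega

theorem IsComparabilityGraph.sgk {G : SimpleGraph V} (hG : IsComparabilityGraph G) : SGK G := by
  obtain ⟨r, hr, hrG⟩ := hG
  intro s k hk
  let _ : PartialOrder (↑s : Set V) :=
    { le := fun v w => r v w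
      le_refl := fun v => hr.refl v
      le_trans := fun u v w => hr.trans u v w
      le_antisymm := fun v w h h' => Subtype.ext (hr.antisymm v w h h') }
  refine exists_saturated_of_partialOrder (fun v w => ?_) hk
  rw [lt_iff_le_and_ne, lt_iff_le_and_ne, SimpleGraph.comap_adj, hrG]
  have : (v : V) ≠ w ↔ v ≠ w := Subtype.coe_injective.ne_iff
  change ((v : V) ≠ w ∧ (r v w ∨ r w v)) ↔ (r v w ∧ v ≠ w) ∨ (r w v ∧ w ≠ v)
  rw [this, ne_comm (a := w)]
  tauto

end GreeneKleitman

section Construction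

/-- Rows `ρ < N` have `ρ + 1` elements. Inside a row the order is that of the positions; the
elements at position `ρ - 1` of rows `ρ < N` form the spine, an ascending chain, and these
comparabilities generate the order. Rows from `N` on are not related to any other row. -/
def spineRel (N : ℕ) (v w : ℕ × ℕ) : Prop :=
  (v.1 = w.1 ∧ v.2 ≤ w.2) ∨ (v.1 < w.1 ∧ w.1 < N ∧ v.2 ≤ v.1 - 1 ∧ w.1 - 1 ≤ w.2)

/-- The comparability graph of the order `spineRel N`, on vertices labelled by `φ`. -/
def spineGraph {V : Type*} (N : ℕ) (φ : V → ℕ × ℕ) : SimpleGraph V where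
  Adj v w := v ≠ w ∧ (spineRel N (φ v) (φ w) ∨ spineRel N (φ w) (φ v))
  symm := ⟨fun _ _ h => ⟨h.1.symm, h.2.symm⟩⟩
  loopless := ⟨fun _ h => h.1 rfl⟩

variable {V : Type*} {N : ℕ} {φ : V → ℕ × ℕ}

theorem isComparabilityGraph_spineGraph (hφ : Function.Injective φ) :
    IsComparabilityGraph (spineGraph N φ) := by
  refine ⟨fun v w => spineRel N (φ v) (φ w), ?_, fun v w => Iff.rfl⟩
  exact
    { refl := fun v => .inl ⟨rfl, le_rfl⟩
      trans := fun u v w h1 h2 => by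
        unfold spineRel at *
        omega
      antisymm := fun v w h1 h2 => hφ <| by
        unfold spineRel at h1 h2
        ext <;> omega }

theorem isComparabilityGraph_compl_spineGraph :
    IsComparabilityGraph (spineGraph N φ)ᶜ := by
  refine ⟨fun v w => v = w ∨ ((φ v).1 < (φ w).1 ∧ ¬ spineRel N (φ v) (φ w)), ?_, fun v w => ?_⟩
  · exact
      { refl := fun v => .inl rfl
        trans := fun u v w h1 h2 => by
          rcases h1 with rfl | h1
          · exact h2
          · rcases h2 with rfl | h2
            · exact .inr h1
            · right
              unfold spineRel at *
              omega
        antisymm := fun v w h1 h2 => by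
          rcases h1 with h1 | h1
          · exact h1
          · rcases h2 with h2 | h2
            · exact h2.symm
            · omega }
  · simp only [SimpleGraph.compl_adj, spineGraph]
    constructor
    · rintro ⟨hne, h⟩
      refine ⟨hne, ?_⟩
      simp only [hne, hne.symm, false_or, ne_eq, not_false_eq_true, true_and] at h ⊢
      unfold spineRel at *
      omega
    · rintro ⟨hne, h⟩
      refine ⟨hne, fun h' => ?_⟩
      simp only [hne, hne.symm, false_or] at h
      have := h'.2
      unfold spineRel at *
      omega

/-- The colors of a maximum union of `k` antichains of the spine order. -/
def spineColor (k r : ℕ) (p : ℕ × ℕ) : ℕ :=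
  if p.1 < r then
    if p.2 = p.1 ∧ 1 ≤ p.1 then k - 1 else if p.2 < p.1 ∧ p.2 + 1 < k then p.2 else k
  else p.2

/-- A partition of the spine order into chains: one chain along the spine, the rows above `ρ₀`,
and singletons. -/
def spineChain (ρ₀ : ℕ) (p : ℕ × ℕ) : ℕ × ℕ :=
  if ρ₀ < p.1 then (p.1, 0)
  else if p.2 = p.1 - 1 ∨ (p.1 = ρ₀ ∧ p.2 = ρ₀) then (0, 0) else (p.1, p.2 + 1)

variable {size : ℕ → ℕ} {R : ℕ}

theorem spineGraph_saturated_meets_colors [Fintype V] (hφ : Function.Injective φ)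
    (hrange : ∀ p, p ∈ Set.range φ ↔ p.1 < R ∧ p.2 < size p.1)
    (hsize : ∀ ρ < N, size ρ = ρ + 1) (hNR : N ≤ R) {k ρ₀ r : ℕ} (h0 : 1 ≤ ρ₀) (h0r : ρ₀ < r)
    (hrN : r ≤ N) (hk : 0 < k) (hk0 : ρ₀ ≤ k) (hk1 : k ≤ ρ₀ + 1) {f : V → V}
    (hf : IsCliquePartition (spineGraph N φ) f) (hfk : knorm f k = alphak (spineGraph N φ) k)
    (v : V) (hv : k ≤ spineColor k r (φ v)) (i : ℕ) (hi : i < k) :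
    ∃ w, f w = f v ∧ spineColor k r (φ w) = i := by
  refine saturated_meets_colors (col := fun v => spineColor k r (φ v))
    (g := fun v => spineChain ρ₀ (φ v)) ?_ ?_ ?_ hf hfk v hv i hi
  · rintro v w h hv ⟨hne, hadj⟩
    have hne' : φ v ≠ φ w := hφ.ne hne
    have hrv := (hrange (φ v)).1 ⟨v, rfl⟩
    have hrw := (hrange (φ w)).1 ⟨w, rfl⟩
    have hsv := hsize (φ v).1
    have hsw := hsize (φ w).1
    rw [Ne, Prod.ext_iff] at hne'
    unfold spineRel at hadj
    dsimp only [spineColor] at h hv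
    split_ifs at h hv <;> omega
  · intro v w h hne
    have hne' : φ v ≠ φ w := hφ.ne hne
    have hrv := (hrange (φ v)).1 ⟨v, rfl⟩
    have hrw := (hrange (φ w)).1 ⟨w, rfl⟩
    have hsv := hsize (φ v).1
    have hsw := hsize (φ w).1
    rw [Ne, Prod.ext_iff] at hne'
    refine ⟨hne, ?_⟩
    unfold spineRel
    dsimp only [spineChain] at h
    split_ifs at h <;> rw [Prod.ext_iff] at h <;> dsimp only at h <;> omega
  · intro v hv i hi
    suffices h : ∃ p : ℕ × ℕ, (p.1 < R ∧ p.2 < size p.1) ∧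
        spineChain ρ₀ p = spineChain ρ₀ (φ v) ∧ spineColor k r p = i by
      obtain ⟨p, hp, h1, h2⟩ := h
      obtain ⟨w, rfl⟩ := (hrange p).2 hp
      exact ⟨w, h1, h2⟩
    have hrv := (hrange (φ v)).1 ⟨v, rfl⟩
    have hsv := hsize (φ v).1
    generalize φ v = q at *
    obtain ⟨ρ, j⟩ := q
    dsimp only at *
    by_cases hρ : ρ₀ < ρ
    · refine ⟨(ρ, if i + 1 = k ∧ ρ < r then ρ else i), ⟨hrv.1, ?_⟩, ?_, ?_⟩
      · dsimp only [spineColor] at hv ⊢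
        split_ifs at hv ⊢ <;> omega
      · simp [spineChain, hρ]
      · dsimp only [spineColor]
        split_ifs <;> omega
    · have hX : spineChain ρ₀ (ρ, j) = (0, 0) := by
        dsimp only [spineColor] at hv
        dsimp only [spineChain]
        split_ifs at hv ⊢ <;> first | rfl | omega
      rw [hX]
      have hs1 := hsize ρ₀
      have hs2 := hsize (i + 1)
      refine ⟨if i + 1 = k then (ρ₀, ρ₀) else (i + 1, i), ?_, ?_, ?_⟩
      · split_ifs <;> dsimp only <;> omega
      · split_ifs <;> dsimp only [spineChain] <;> split_ifs <;> first | rfl | omega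
      · split_ifs <;> dsimp only [spineColor] <;> split_ifs <;> omega

theorem polyunsatG_spineGraph [Fintype V] (hφ : Function.Injective φ)
    (hrange : ∀ p, p ∈ Set.range φ ↔ p.1 < R ∧ p.2 < size p.1)
    (hsize : ∀ ρ < N, size ρ = ρ + 1) (hNR : N ≤ R)
    (hω : cliqueNumber (spineGraph N φ) = N + 1) : PolyunsatG (spineGraph N φ) := by
  have main : ∀ k l, 0 < k → l ≤ N → k + 2 ≤ l → ¬ ∃ f : V → V,
      IsCliquePartition (spineGraph N φ) f ∧ knorm f k = alphak (spineGraph N φ) k ∧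
        knorm f l = alphak (spineGraph N φ) l := by
    rintro k l hk hl hkl ⟨f, hf, hfk, hfl⟩
    have hrow : ∀ u v, f u = f v → φ u = φ v ∨ spineRel N (φ u) (φ v) ∨
        spineRel N (φ v) (φ u) := fun u v h => by
      by_cases hne : u = v
      · exact .inl (hne ▸ rfl)
      · exact .inr (hf.adj u v h hne).2
    have hs := hsize 0 (by omega)
    obtain ⟨x, hx⟩ := (hrange (0, 0)).2 ⟨by dsimp only; omega, by dsimp only; omega⟩
    obtain ⟨w, hw1, hw2⟩ := spineGraph_saturated_meets_colors hφ hrange hsize hNR (k := l)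
      (ρ₀ := l - 1) (r := N) (by omega) (by omega) le_rfl (by omega) (by omega) (by omega) hf hfl
      x (by rw [hx]; dsimp only [spineColor]; split_ifs <;> omega) k (by omega)
    have hwv := hrow w x hw1
    have hrw := (hrange (φ w)).1 ⟨w, rfl⟩
    have hw : φ w = (k + 1, k) := by
      rw [hx] at hwv
      unfold spineRel at hwv
      dsimp only [spineColor] at hw2
      rw [Prod.ext_iff] at hwv ⊢
      dsimp only at hwv ⊢
      have := hsize (φ w).1
      split_ifs at hw2 <;> omega
    obtain ⟨u, hu1, hu2⟩ := spineGraph_saturated_meets_colors hφ hrange hsize hNR (k := k)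
      (ρ₀ := k) (r := k + 1) (by omega) (by omega) (by omega) hk (by omega) (by omega) hf hfk
      w (by rw [hw]; simp [spineColor]) (k - 1) (by omega)
    have huw := hrow u w hu1
    have hux := hrow u x (hu1.trans hw1)
    have hru := (hrange (φ u)).1 ⟨u, rfl⟩
    have := hsize (φ u).1
    rw [hx] at hux
    rw [hw] at huw
    unfold spineRel at hux huw
    dsimp only [spineColor] at hu2
    rw [Prod.ext_iff] at hux huw
    dsimp only at hux huw
    split_ifs at hu2 <;> omega
  rintro k l hk hl hkc hlc (h | h) ⟨f, hf, h1, h2⟩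
  · exact main k l hk (by omega) h ⟨f, hf, h1, h2⟩
  · exact main l k hl (by omega) h ⟨f, hf, h2, h1⟩

theorem csSup_nat_eq {s : Set ℕ} {m : ℕ} (h : m ∈ s) (hle : ∀ x ∈ s, x ≤ m) : sSup s = m :=
  le_antisymm (csSup_le ⟨m, h⟩ hle) (le_csSup ⟨m, hle⟩ h)

theorem cliqueNumber_spineGraph [Fintype V] (hφ : Function.Injective φ)
    (hrange : ∀ p, p ∈ Set.range φ ↔ p.1 < R ∧ p.2 < size p.1)
    (hsize : ∀ ρ < N, size ρ = ρ + 1) (hsize' : ∀ ρ < R, size ρ ≤ N + 1) (hNR : N ≤ R)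
    (hN : 2 ≤ N) : cliqueNumber (spineGraph N φ) = N + 1 := by
  apply csSup_nat_eq
  · have hex : ∀ i : Fin (N + 1), ∃ v, φ v =
        if (i : ℕ) < N then ((i : ℕ), (i : ℕ) - 1) else (N - 1, N - 1) := fun i => by
      refine (hrange _).2 ?_
      have h1 := hsize (i : ℕ)
      have h2 := hsize (N - 1)
      split_ifs <;> dsimp only <;> omega
    choose u hu using hex
    have hinj : Function.Injective u := fun i j h => by
      have := (hu i).symm.trans ((congrArg φ h).trans (hu j))
      ext
      split_ifs at this <;> rw [Prod.ext_iff] at this <;> dsimp only at this <;> omega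
    refine ⟨Set.range u, ?_, ?_⟩
    · rintro _ ⟨i, rfl⟩ _ ⟨j, rfl⟩ hne
      refine ⟨hne, ?_⟩
      have hij : i ≠ j := fun h => hne (h ▸ rfl)
      have hij' : (i : ℕ) ≠ j := Fin.val_ne_of_ne hij
      rw [hu, hu]
      unfold spineRel
      split_ifs <;> dsimp only <;> omega
    · rw [← Set.image_univ, Set.ncard_image_of_injective _ hinj]
      simp
  · rintro _ ⟨s, hs, rfl⟩
    let h : V → ℕ := fun v => if (φ v).2 + 1 < (φ v).1 ∨ N ≤ (φ v).1 ∨ (φ v).1 = 0 then (φ v).2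
      else (φ v).2 + 1
    have : s.ncard ≤ (Set.Iio (N + 1)).ncard := by
      refine Set.ncard_le_ncard_of_injOn h (fun v _ => ?_) (fun v hv w hw hvw => ?_)
        (Set.finite_Iio _)
      · have hrv := (hrange (φ v)).1 ⟨v, rfl⟩
        have h1 := hsize (φ v).1
        have h2 := hsize' (φ v).1
        dsimp only [h]
        rw [Set.mem_Iio]
        split_ifs <;> omega
      · by_contra hne
        have hadj := (hs hv hw hne).2
        have hne' : φ v ≠ φ w := hφ.ne hne
        have hrv := (hrange (φ v)).1 ⟨v, rfl⟩
        have hrw := (hrange (φ w)).1 ⟨w, rfl⟩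
        have hsv := hsize (φ v).1
        have hsw := hsize (φ w).1
        rw [Ne, Prod.ext_iff] at hne'
        unfold spineRel at hadj
        dsimp only [h] at hvw
        split_ifs at hvw <;> omega
    simpa using this

theorem indepNumber_spineGraph [Fintype V]
    (hrange : ∀ p, p ∈ Set.range φ ↔ p.1 < R ∧ p.2 < size p.1)
    (hsize : ∀ ρ < N, size ρ = ρ + 1) (hsize' : ∀ ρ < R, 1 ≤ size ρ) (hN : 2 ≤ N) (hNR : N ≤ R) :
    indepNumber (spineGraph N φ) = R - 1 := by
  apply csSup_nat_eq
  · have hex : ∀ i : Fin (R - 1), ∃ v, φ v = ((i : ℕ) + 1, size ((i : ℕ) + 1) - 1) :=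
      fun i => by
      refine (hrange _).2 ?_
      have := hsize' ((i : ℕ) + 1)
      dsimp only
      omega
    choose u hu using hex
    have hinj : Function.Injective u := fun i j h => by
      have := (hu i).symm.trans ((congrArg φ h).trans (hu j))
      rw [Prod.ext_iff] at this
      ext
      dsimp only at this
      omega
    refine ⟨Set.range u, ?_, ?_⟩
    · rintro _ ⟨i, rfl⟩ _ ⟨j, rfl⟩ ⟨hne, hadj⟩
      have hij : i ≠ j := fun h => hne (h ▸ rfl)
      have hij' : (i : ℕ) ≠ j := Fin.val_ne_of_ne hij
      have h1 := hsize ((i : ℕ) + 1)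
      have h2 := hsize ((j : ℕ) + 1)
      rw [hu, hu] at hadj
      unfold spineRel at hadj
      dsimp only at hadj
      omega
    · rw [← Set.image_univ, Set.ncard_image_of_injective _ hinj]
      simp
  · rintro _ ⟨s, hs, rfl⟩
    have : s.ncard ≤ (Set.Iio (R - 1)).ncard := by
      refine Set.ncard_le_ncard_of_injOn (fun v => (φ v).1 - 1) (fun v _ => ?_)
        (fun v hv w hw hvw => ?_) (Set.finite_Iio _)
      · have hrv := (hrange (φ v)).1 ⟨v, rfl⟩
        rw [Set.mem_Iio]
        omega
      · by_contra hne
        refine hs hv hw ⟨hne, ?_⟩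
        have hrv := (hrange (φ v)).1 ⟨v, rfl⟩
        have hrw := (hrange (φ w)).1 ⟨w, rfl⟩
        have hsv := hsize (φ v).1
        have hsw := hsize (φ w).1
        unfold spineRel
        dsimp only at hvw
        omega
    simpa using this

theorem exists_sum_eq {c : ℕ} (q m : ℕ) (h1 : q ≤ m) (h2 : m ≤ c * q) :
    ∃ s : ℕ → ℕ, (∀ i, i < q → 1 ≤ s i ∧ s i ≤ c) ∧ ∑ i ∈ range q, s i = m := by
  induction q generalizing m with
  | zero => exact ⟨fun _ => 0, fun i hi => absurd hi (Nat.not_lt_zero i), by simp_all⟩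
  | succ q ih =>
    rw [Nat.mul_succ] at h2
    obtain ⟨x, hx1, hx2, hx3, hx4, hx5⟩ : ∃ x, 1 ≤ x ∧ x ≤ c ∧ x ≤ m ∧ q ≤ m - x ∧
        m - x ≤ c * q := by
      by_cases h : c + q ≤ m
      · refine ⟨c, ?_, le_rfl, ?_, ?_, ?_⟩ <;> try omega
        rcases Nat.eq_zero_or_pos c with rfl | hc
        · omega
        · exact hc
      · have : q ≤ c * q := Nat.le_mul_of_pos_left q (by
          rcases Nat.eq_zero_or_pos c with rfl | hc
          · omega
          · exact hc)
        exact ⟨m - q, by omega, by omega, by omega, by omega, by omega⟩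
    obtain ⟨s, hs, hsum⟩ := ih (m - x) hx4 hx5
    refine ⟨fun i => if i = q then x else s i, fun i hi => ?_, ?_⟩
    · dsimp only
      split_ifs with h
      · exact ⟨hx1, hx2⟩
      · exact hs i (by omega)
    · rw [sum_range_succ, sum_congr rfl (g := s)]
      · simp only [if_true]
        change (∑ i ∈ range q, s i) + x = m
        omega
      · intro i hi
        rw [mem_range] at hi
        exact if_neg (by omega)

theorem exists_polyunsat {n c a : ℕ} (hc : 3 ≤ c) (h1 : c ≤ a + 2)
    (h2 : a + 1 + (c - 1).choose 2 ≤ n) (h3 : n + (c - 1).choose 2 ≤ c * a + 1) :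
    ∃ G : SimpleGraph (Fin n), SGK G ∧ PolyunsatG G ∧ cliqueNumber G = c ∧ indepNumber G = a ∧
      IsComparabilityGraph G ∧ IsComparabilityGraph Gᶜ := by
  obtain ⟨d, rfl⟩ : ∃ d, c = d + 3 := ⟨c - 3, by omega⟩
  obtain ⟨e, rfl⟩ : ∃ e, a = d + 1 + e := ⟨a - (d + 1), by omega⟩
  have hch : (d + 3 - 1).choose 2 * 2 = (d + 2) * (d + 1) := by
    rw [Nat.choose_two_right, Nat.div_mul_cancel (Nat.even_mul_pred_self _).two_dvd]
    rfl
  have hT : (∑ i ∈ range (d + 2), (i + 1)) * 2 = (d + 2) * (d + 3) := by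
    have := Finset.sum_range_id_mul_two (d + 3)
    rw [sum_range_succ'] at this
    simp only [add_zero] at this
    rw [this]
    simp [mul_comm]
  obtain ⟨s, hs, hsum⟩ := exists_sum_eq (c := d + 3) e (n - ∑ i ∈ range (d + 2), (i + 1))
    (by have : (d + 2) * (d + 3) = (d + 2) * (d + 1) + 2 * d + 4 := by ring
        omega)
    (by have : (d + 3) * (d + 1 + e) * 2 + 2 = (d + 3) * e * 2 + (d + 2) * (d + 3) +
            (d + 2) * (d + 1) := by ring
        omega)
  let size : ℕ → ℕ := fun ρ => if ρ < d + 2 then ρ + 1 else s (ρ - (d + 2))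
  let F : Finset (Σ _ : ℕ, ℕ) := (range (d + 2 + e)).sigma fun ρ => range (size ρ)
  have hF : Fintype.card F = n := by
    rw [Fintype.card_coe, card_sigma, sum_range_add]
    simp only [Finset.card_range]
    have e1 : ∑ ρ ∈ range (d + 2), size ρ = ∑ ρ ∈ range (d + 2), (ρ + 1) :=
      sum_congr rfl fun ρ hρ => if_pos (mem_range.1 hρ)
    have e2 : ∑ ρ ∈ range e, size (d + 2 + ρ) = ∑ ρ ∈ range e, s ρ :=
      sum_congr rfl fun ρ _ => by simp [size]
    rw [e1, e2, hsum]
    have : (d + 2) * (d + 3) = (d + 2) * (d + 1) + 2 * d + 4 := by ring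
    omega
  let E : Fin n ≃ F := (Fintype.equivFinOfCardEq hF).symm
  let φ : Fin n → ℕ × ℕ := fun v => ((E v).1.1, (E v).1.2)
  have hφ : Function.Injective φ := fun v w h => by
    apply E.injective
    apply Subtype.ext
    rw [Prod.ext_iff] at h
    exact Sigma.ext h.1 (heq_of_eq h.2)
  have hrange : ∀ p, p ∈ Set.range φ ↔ p.1 < d + 2 + e ∧ p.2 < size p.1 := by
    rintro ⟨ρ, j⟩
    constructor
    · rintro ⟨v, hv⟩
      have := (E v).2
      simp only [F, mem_sigma, mem_range] at this
      rw [← hv]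
      exact this
    · intro h
      refine ⟨E.symm ⟨⟨ρ, j⟩, by simpa [F] using h⟩, ?_⟩
      simp [φ]
  have hsize : ∀ ρ < d + 2, size ρ = ρ + 1 := fun ρ h => if_pos h
  have hsize1 : ∀ ρ < d + 2 + e, 1 ≤ size ρ ∧ size ρ ≤ d + 2 + 1 := fun ρ h => by
    dsimp only [size]
    split_ifs
    · omega
    · exact hs _ (by omega)
  have hcomp := isComparabilityGraph_spineGraph (N := d + 2) hφ
  have hω := cliqueNumber_spineGraph hφ hrange hsize (fun ρ h => (hsize1 ρ h).2) (by omega)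
    (by omega)
  refine ⟨spineGraph (d + 2) φ, hcomp.sgk, polyunsatG_spineGraph hφ hrange hsize (by omega) hω,
    hω, ?_, hcomp, isComparabilityGraph_compl_spineGraph⟩
  rw [indepNumber_spineGraph hrange hsize (fun ρ h => (hsize1 ρ h).1) (by omega) (by omega)]
  omega

end Construction

section Necessity

variable {V W : Type*} [Fintype V] [Fintype W] {G : SimpleGraph V} {H : SimpleGraph W}

theorem alphak_le_of_iso (e : H ≃g G) (k : ℕ) : alphak G k ≤ alphak H k := by
  obtain ⟨col, hcol, hc⟩ := exists_coloring_alphak G k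
  rw [← hc]
  refine le_trans (le_of_eq ?_) (card_filter_lt_le_alphak k (fun w => col (e w)) fun v w h hv hvw =>
    hcol _ _ h hv (e.map_adj_iff.2 hvw))
  refine (card_bij (fun w _ => e w) (fun w hw => by simpa using hw)
    (fun v _ w _ h => e.injective h) fun v hv => ⟨e.symm v, by simpa using hv, by simp⟩).symm

theorem alphak_eq_of_iso (e : H ≃g G) (k : ℕ) : alphak G k = alphak H k :=
  le_antisymm (alphak_le_of_iso e k) (alphak_le_of_iso e.symm k)

theorem knorm_conj (e : W ≃ V) (f : W → W) (k : ℕ) :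
    knorm (fun v => e (f (e.symm v))) k = knorm f k := by
  refine Fintype.sum_equiv e.symm _ _ fun i => ?_
  rw [← Set.ncard_image_of_injective (f ⁻¹' {e.symm i}) e.injective]
  congr 2
  ext v
  simp [Equiv.eq_symm_apply]

theorem SGK.exists_saturated (hG : SGK G) {k : ℕ} (hk : 0 < k) :
    ∃ f : V → V, IsCliquePartition G f ∧ knorm f k = alphak G k ∧
      knorm f (k + 1) = alphak G (k + 1) := by
  obtain ⟨f, hf, h1, h2⟩ := hG univ k hk
  let e : G.induce ((univ : Finset V) : Set V) ≃g G :=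
    ⟨Equiv.subtypeUnivEquiv (by simp), by intros; rfl⟩
  refine ⟨fun v => e (f (e.symm v)), fun i v hv w hw hne => ?_, ?_, ?_⟩
  · have hv : f (e.symm v) = e.symm i := by
      rw [← e.symm_apply_apply (f _)]
      exact congrArg _ hv
    have hw : f (e.symm w) = e.symm i := by
      rw [← e.symm_apply_apply (f _)]
      exact congrArg _ hw
    exact e.symm.map_adj_iff.1 (hf (e.symm i) hv hw (e.symm.injective.ne hne))
  · rw [alphak_eq_of_iso e, ← h1]
    exact knorm_conj e.toEquiv f k
  · rw [alphak_eq_of_iso e, ← h2]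
    exact knorm_conj e.toEquiv f (k + 1)

theorem knorm_concave (f : V → V) (k : ℕ) :
    knorm f (k + 2) + knorm f k ≤ 2 * knorm f (k + 1) := by
  simp only [knorm, mul_sum, ← sum_add_distrib]
  exact sum_le_sum fun i _ => by omega

theorem SGK.alphak_two_le (hG : SGK G) : alphak G 2 ≤ 2 * alphak G 1 := by
  obtain ⟨f, hf, h1, -⟩ := hG.exists_saturated one_pos
  have := knorm_concave f 0
  have := alphak_le_knorm hf 2
  simp only [zero_add] at *
  omega

theorem SGK.alphak_concave (hG : SGK G) {k : ℕ} (hk : 0 < k) :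
    alphak G (k + 2) + alphak G k ≤ 2 * alphak G (k + 1) := by
  obtain ⟨f, hf, h1, h2⟩ := hG.exists_saturated hk
  have := knorm_concave f k
  have := alphak_le_knorm hf (k + 2)
  omega

theorem SGK.alphak_strictly_concave (hG : SGK G) (hP : PolyunsatG G) {k : ℕ} (hk : 0 < k)
    (hkc : k + 2 < cliqueNumber G) :
    alphak G (k + 2) + alphak G k < 2 * alphak G (k + 1) := by
  obtain ⟨f, hf, h1, h2⟩ := hG.exists_saturated hk
  have := knorm_concave f k
  have := alphak_le_knorm hf (k + 2)
  have : knorm f (k + 2) ≠ alphak G (k + 2) := fun h =>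
    hP k (k + 2) hk (by omega) (by omega) hkc (.inl le_rfl) ⟨f, hf, h1, h⟩
  omega

theorem alphak_one {V : Type*} (G : SimpleGraph V) : alphak G 1 = indepNumber G := by
  unfold alphak indepNumber
  congr 1
  ext m
  constructor
  · rintro ⟨A, hA, h⟩
    exact ⟨A 0, hA 0, by rwa [Set.iUnion, iSup_unique] at h⟩
  · rintro ⟨s, hs, h⟩
    exact ⟨fun _ => s, fun _ => hs, by rwa [Set.iUnion_const]⟩

theorem alphak_le_card (G : SimpleGraph V) (k : ℕ) : alphak G k ≤ Fintype.card V := by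
  obtain ⟨col, -, hc⟩ := exists_coloring_alphak G k
  rw [← hc]
  exact card_le_univ _

theorem ncard_le_cliqueNumber {s : Set V} (hs : G.IsClique s) : s.ncard ≤ cliqueNumber G := by
  refine le_csSup ⟨Fintype.card V, ?_⟩ ⟨s, hs, rfl⟩
  rintro _ ⟨t, -, rfl⟩
  rw [← Nat.card_eq_fintype_card]
  exact Set.ncard_le_card _

theorem exists_isClique_ncard_eq (G : SimpleGraph V) :
    ∃ s : Set V, G.IsClique s ∧ s.ncard = cliqueNumber G := by
  refine Nat.sSup_mem (s := {n | ∃ s : Set V, G.IsClique s ∧ s.ncard = n})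
    ⟨_, ∅, by simp, rfl⟩ ⟨Fintype.card V, ?_⟩
  rintro _ ⟨t, -, rfl⟩
  rw [← Nat.card_eq_fintype_card]
  exact Set.ncard_le_card _

theorem SGK.alphak_cliqueNumber (hG : SGK G) (h0 : 0 < cliqueNumber G) :
    alphak G (cliqueNumber G) = Fintype.card V := by
  classical
  obtain ⟨f, hf, h1, -⟩ := hG.exists_saturated h0
  rw [← h1, knorm, ← card_univ,
    card_eq_sum_card_fiberwise (f := f) (t := univ) (fun _ _ => by simp)]
  refine sum_congr rfl fun i _ => ?_
  rw [min_eq_right (ncard_le_cliqueNumber (hf i)), ← Set.ncard_coe_finset]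
  congr 1
  ext v
  simp

theorem alphak_lt_card (G : SimpleGraph V) {k : ℕ} (hk : k < cliqueNumber G) :
    alphak G k < Fintype.card V := by
  refine lt_of_le_of_ne (alphak_le_card G k) fun h => ?_
  obtain ⟨col, hcol, hc⟩ := exists_coloring_alphak G k
  have hlt : ∀ v, col v < k := by
    rw [h, card_eq_iff_eq_univ, filter_eq_self] at hc
    exact fun v => hc v (mem_univ v)
  obtain ⟨s, hs, hsc⟩ := exists_isClique_ncard_eq G
  have : s.ncard ≤ (Set.Iio k).ncard :=
    Set.ncard_le_ncard_of_injOn col (fun v _ => hlt v) (fun v hv w hw hvw => by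
      by_contra hne
      exact hcol v w hvw (hlt v) (hs hv hw hne)) (Set.finite_Iio _)
  simp only [Set.ncard_Iio_nat] at this
  omega

theorem bounds_of_strictly_concave {A : ℕ → ℕ} {a n d : ℕ} (h1 : A 1 = a) (h2 : A 2 ≤ 2 * a)
    (hconc : A (d + 3) + A (d + 1) ≤ 2 * A (d + 2))
    (hstrict : ∀ k, 0 < k → k ≤ d → A (k + 2) + A k < 2 * A (k + 1))
    (hlt : A (d + 2) < n) (hn : A (d + 3) = n) :
    d + 1 ≤ a ∧ 2 * a + 2 + (d + 1) * (d + 2) ≤ 2 * n ∧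
      2 * n + (d + 1) * (d + 2) ≤ 2 * ((d + 3) * a) + 2 := by
  have low : ∀ i ≤ d, A (d + 1 - i) + (i + 1) ≤ A (d + 1 - i + 1) := by
    intro i hi
    induction i with
    | zero =>
      change A (d + 1) + (0 + 1) ≤ A (d + 2)
      omega
    | succ i ih =>
      have := ih (by omega)
      have h := hstrict (d - i) (by omega) (by omega)
      rw [show d + 1 - i = d - i + 1 by omega] at this
      rw [show d + 1 - (i + 1) = d - i by omega]
      change _ ≤ A (d - i + 2) at this
      omega
  have up : ∀ i ≤ d, A (i + 2) + i ≤ A (i + 1) + a := by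
    intro i hi
    induction i with
    | zero =>
      simp only [zero_add]
      omega
    | succ i ih =>
      have := ih (by omega)
      have h := hstrict (i + 1) (by omega) (by omega)
      change A (i + 1 + 2) + (i + 1) ≤ A (i + 2) + a
      change _ < 2 * A (i + 2) at h
      omega
  have lowsum : ∀ i ≤ d + 1, 2 * A (d + 2 - i) + i * (i + 1) + 2 ≤ 2 * n := by
    intro i hi
    induction i with
    | zero =>
      simp only [Nat.sub_zero]
      omega
    | succ i ih =>
      have := ih (by omega)
      have h := low i (by omega)
      rw [show d + 1 - i + 1 = d + 2 - i by omega] at h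
      rw [show d + 2 - (i + 1) = d + 1 - i by omega]
      nlinarith
  have upsum : ∀ i ≤ d + 1, 2 * A (i + 1) + i * i ≤ 2 * a + 2 * (i * a) + i := by
    intro i hi
    induction i with
    | zero =>
      simp only [zero_add]
      omega
    | succ i ih =>
      have := ih (by omega)
      have h := up i (by omega)
      have h' : (i + 1) * (i + 1) = i * i + 2 * i + 1 := by ring
      have h'' : (i + 1) * a = i * a + a := by ring
      change 2 * A (i + 2) + _ ≤ _
      omega
  have hl := low d le_rfl
  have hu := up d le_rfl
  have hls := lowsum (d + 1) le_rfl
  have hus := upsum (d + 1) le_rfl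
  rw [show d + 2 - (d + 1) = 1 by omega, h1] at hls
  rw [show d + 1 - d = 1 by omega] at hl
  refine ⟨by omega, ?_, ?_⟩
  · rw [show d + 1 + 1 = d + 2 from rfl] at hls
    omega
  · change 2 * A (d + 2) + _ ≤ _ at hus
    nlinarith

theorem SGK.bounds_of_polyunsat (hG : SGK G) (hP : PolyunsatG G) {c a : ℕ} (hc : 3 ≤ c)
    (hω : cliqueNumber G = c) (hα : indepNumber G = a) :
    c ≤ a + 2 ∧ a + 1 + (c - 1).choose 2 ≤ Fintype.card V ∧
      Fintype.card V + (c - 1).choose 2 ≤ c * a + 1 := by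
  obtain ⟨d, rfl⟩ : ∃ d, c = d + 3 := ⟨c - 3, by omega⟩
  have h1 := alphak_one G
  have hch : (d + 3 - 1).choose 2 * 2 = (d + 2) * (d + 1) := by
    rw [Nat.choose_two_right, Nat.div_mul_cancel (Nat.even_mul_pred_self _).two_dvd]
    rfl
  have hcomm := mul_comm (d + 2) (d + 1)
  obtain ⟨b1, b2, b3⟩ := bounds_of_strictly_concave (A := alphak G) (d := d) (h1.trans hα)
    (by have := hG.alphak_two_le
        omega)
    (hG.alphak_concave (Nat.succ_pos d))
    (fun k hk hkd => hG.alphak_strictly_concave hP hk (by omega))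
    (alphak_lt_card G (by omega)) (by rw [← hω]; exact hG.alphak_cliqueNumber (by omega))
  omega

end Necessity

/-- For positive integers `n, c, a` with `c ≥ 3`: there is an `n`-vertex polyunsaturated
SGK graph with clique number `c` and independence number `a` iff `a ≥ c - 2`,
`n ≥ a + 1 + (c-1).choose 2` and `n ≤ c * a + 1 - (c-1).choose 2`; moreover, in that case
the graph may be chosen so that it and its complement are comparability graphs. -/
theorem statement12 (n c a : ℕ) (hn : 0 < n) (hc : 3 ≤ c) (ha : 0 < a) :
    ((∃ G : SimpleGraph (Fin n),
        SGK G ∧ PolyunsatG G ∧ cliqueNumber G = c ∧ indepNumber G = a) ↔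
      (c ≤ a + 2 ∧ a + 1 + (c - 1).choose 2 ≤ n ∧ n + (c - 1).choose 2 ≤ c * a + 1)) ∧
    ((c ≤ a + 2 ∧ a + 1 + (c - 1).choose 2 ≤ n ∧ n + (c - 1).choose 2 ≤ c * a + 1) →
      ∃ G : SimpleGraph (Fin n),
        SGK G ∧ PolyunsatG G ∧ cliqueNumber G = c ∧ indepNumber G = a ∧
        IsComparabilityGraph G ∧ IsComparabilityGraph Gᶜ) := by
  refine ⟨⟨fun ⟨G, hG, hP, hω, hα⟩ => ?_, fun ⟨h1, h2, h3⟩ => ?_⟩,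
    fun ⟨h1, h2, h3⟩ => exists_polyunsat hc h1 h2 h3⟩
  · simpa using hG.bounds_of_polyunsat hP hc hω hα
  · obtain ⟨G, hG, hP, hω, hα, -⟩ := exists_polyunsat hc h1 h2 h3
    exact ⟨G, hG, hP, hω, hα⟩
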